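/- Let M be a finite automatic algebra and suppose there are distinct letters a, b ∈ Σ with q·a = q·b for all q ∈ Q. Let N be the submagma of M on M ∖ {a}. Then there is an injective multiplication-preserving map from M into N × N; explicitly, the map φ with φ(x) = (x, 0) for x ∈ N and φ(a) = (b, b) is such an embedding. Consequently every magma embeds into a power of M if and only if it embeds into a power of N. -/

import Mathlib

/-- The multiplication of an automatic algebra with state set `Q`, letter set `S`,
zero element `none`, and partial transition function `δ`. -/
def autMul {Q S : Type} (δ : Q → S → Option Q) :
    Option (Q ⊕ S) → Option (Q ⊕ S) → Option (Q ⊕ S)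
  | some (Sum.inl q), some (Sum.inr a) => (δ q a).map Sum.inl
  | _, _ => none

/-- A magma `(B, mB)` embeds into some power of a magma `(C, mC)`. -/
def EmbedsInPower {B C : Type} (mB : B → B → B) (mC : C → C → C) : Prop :=
  ∃ (I : Type) (g : B → I → C), Function.Injective g ∧
    ∀ x y : B, g (mB x y) = fun i => mC (g x i) (g y i)

open scoped Classical in
/-- The explicit map `φ : M → N × N` where `N = M ∖ {a}` for a repeated letter `a`:
`φ x = (x, 0)` for `x ∈ N`, and `φ a = (b, b)`. -/
noncomputable def phiRepeat {Q S : Type} (a b : S) (hab : a ≠ b) (x : Option (Q ⊕ S)) :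
    {v : Option (Q ⊕ S) // v ≠ some (Sum.inr a)} ×
      {v : Option (Q ⊕ S) // v ≠ some (Sum.inr a)} :=
  if h : x = some (Sum.inr a) then
    (⟨some (Sum.inr b), by simpa using hab.symm⟩, ⟨some (Sum.inr b), by simpa using hab.symm⟩)
  else (⟨x, h⟩, ⟨none, by simp⟩)

/-- Embeddability into powers is transitive. -/
theorem EmbedsInPower.trans {B C D : Type} {mB : B → B → B} {mC : C → C → C} {mD : D → D → D}
    (hBC : EmbedsInPower mB mC) (hCD : EmbedsInPower mC mD) : EmbedsInPower mB mD := by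
  obtain ⟨I, g, hg, hgm⟩ := hBC
  obtain ⟨J, f, hf, hfm⟩ := hCD
  refine ⟨I × J, fun x p => f (g x p.1) p.2, fun x y h => hg (funext fun i => hf (funext fun j =>
    congrFun h (i, j))), fun x y => ?_⟩
  funext p
  simp only [hgm, hfm]

/-- A magma that embeds into another one embeds into a power of it. -/
theorem EmbedsInPower.of_injective {B C : Type} {mB : B → B → B} {mC : C → C → C} (f : B → C)
    (hf : Function.Injective f) (hfm : ∀ x y, f (mB x y) = mC (f x) (f y)) :
    EmbedsInPower mB mC :=
  ⟨Unit, fun x _ => f x, fun _ _ h => hf (congrFun h ()), fun x y => funext fun _ => hfm x y⟩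

/-- A magma that embeds into the square of another one embeds into a power of it. -/
theorem EmbedsInPower.of_injective_prod {B C : Type} {mB : B → B → B} {mC : C → C → C}
    (f : B → C × C) (hf : Function.Injective f)
    (hfm : ∀ x y, f (mB x y) = (mC (f x).1 (f y).1, mC (f x).2 (f y).2)) :
    EmbedsInPower mB mC := by
  refine ⟨Bool, fun x i => bif i then (f x).1 else (f x).2, fun x y h => hf (Prod.ext
    (congrFun h true) (congrFun h false)), fun x y => ?_⟩
  funext i
  cases i <;> simp [hfm]

/-- A product in an automatic algebra is never a letter. -/
theorem autMul_ne_letter {Q S : Type} (δ : Q → S → Option Q) (x y : Option (Q ⊕ S)) (c : S) :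
    autMul δ x y ≠ some (Sum.inr c) := by
  rcases x with _ | q | s <;> rcases y with _ | r | t <;> simp [autMul]

theorem phiRepeat_letter {Q S : Type} (a b : S) (hab : a ≠ b) :
    phiRepeat (Q := Q) a b hab (some (Sum.inr a)) =
      (⟨some (Sum.inr b), by simpa using hab.symm⟩,
        ⟨some (Sum.inr b), by simpa using hab.symm⟩) := by
  simp [phiRepeat]

theorem phiRepeat_of_ne {Q S : Type} (a b : S) (hab : a ≠ b) {x : Option (Q ⊕ S)}
    (h : x ≠ some (Sum.inr a)) : phiRepeat a b hab x = (⟨x, h⟩, ⟨none, by simp⟩) := by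
  simp [phiRepeat, h]

theorem phiRepeat_injective {Q S : Type} (a b : S) (hab : a ≠ b) :
    Function.Injective (phiRepeat (Q := Q) a b hab) := by
  intro x y h
  by_cases hx : x = some (Sum.inr a) <;> by_cases hy : y = some (Sum.inr a)
  · rw [hx, hy]
  · subst hx
    simp [phiRepeat_letter, phiRepeat_of_ne a b hab hy] at h
  · subst hy
    simp [phiRepeat_letter, phiRepeat_of_ne a b hab hx] at h
  · simpa [phiRepeat_of_ne a b hab hx, phiRepeat_of_ne a b hab hy] using h

/-- Let `M` be a finite automatic algebra with distinct letters `a, b` acting identically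
on the states, and let `N` be the submagma of `M` on `M ∖ {a}` (so there is a
multiplication `nmul` on `N` restricting that of `M`).  Then the explicit map `φ` with
`φ x = (x, 0)` for `x ∈ N` and `φ a = (b, b)` is an injective multiplication-preserving
map from `M` into `N × N`; consequently every magma embeds into a power of `M` iff it
embeds into a power of `N`. -/
theorem remove_repeated_letter
    {Q S : Type} [Fintype Q] [Fintype S]
    (δ : Q → S → Option Q) (a b : S) (hab : a ≠ b) (hact : ∀ q : Q, δ q a = δ q b) :
    ∃ nmul : {v : Option (Q ⊕ S) // v ≠ some (Sum.inr a)} →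
        {v : Option (Q ⊕ S) // v ≠ some (Sum.inr a)} →
        {v : Option (Q ⊕ S) // v ≠ some (Sum.inr a)},
      (∀ x y, (nmul x y : Option (Q ⊕ S)) = autMul δ (x : Option (Q ⊕ S)) y) ∧
      Function.Injective (phiRepeat (Q := Q) a b hab) ∧
      (∀ x y : Option (Q ⊕ S),
        phiRepeat (Q := Q) a b hab (autMul δ x y) =
          (nmul (phiRepeat (Q := Q) a b hab x).1 (phiRepeat (Q := Q) a b hab y).1,
           nmul (phiRepeat (Q := Q) a b hab x).2 (phiRepeat (Q := Q) a b hab y).2)) ∧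
      ∀ (B : Type) (mB : B → B → B),
        EmbedsInPower mB (autMul δ) ↔ EmbedsInPower mB nmul := by
  let nmul (x y : {v : Option (Q ⊕ S) // v ≠ some (Sum.inr a)}) :
      {v : Option (Q ⊕ S) // v ≠ some (Sum.inr a)} :=
    ⟨autMul δ x y, autMul_ne_letter δ x y a⟩
  have hφ : ∀ x y : Option (Q ⊕ S), phiRepeat (Q := Q) a b hab (autMul δ x y) =
      (nmul (phiRepeat (Q := Q) a b hab x).1 (phiRepeat (Q := Q) a b hab y).1,
        nmul (phiRepeat (Q := Q) a b hab x).2 (phiRepeat (Q := Q) a b hab y).2) := by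
    intro x y
    rw [phiRepeat_of_ne a b hab (autMul_ne_letter δ x y a)]
    by_cases hx : x = some (Sum.inr a) <;> by_cases hy : y = some (Sum.inr a)
    · subst hx hy
      simp [phiRepeat_letter, nmul, autMul]
    · subst hx
      simp [phiRepeat_letter, phiRepeat_of_ne a b hab hy, nmul, autMul]
    · subst hy
      rcases x with _ | q | s <;>
        simp [phiRepeat_letter, phiRepeat_of_ne a b hab hx, nmul, autMul, hact]
    · simp [phiRepeat_of_ne a b hab hx, phiRepeat_of_ne a b hab hy, nmul, autMul]
  refine ⟨nmul, fun _ _ => rfl, phiRepeat_injective a b hab, hφ, fun B mB => ⟨fun h => ?_,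
    fun h => ?_⟩⟩
  · exact h.trans (.of_injective_prod _ (phiRepeat_injective a b hab) hφ)
  · exact h.trans (.of_injective _ Subtype.val_injective fun _ _ => rfl)
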